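/- If b ∈ P(m,n) satisfies b_i < b_{i+1} < n for some 1 ≤ i ≤ m−1, then the matchings C(P_i(b)) and C(b) coincide. Consequently, any two P-equivalent sequences b, b′ ∈ P(m,n) satisfy C(b) = C(b′); in particular, if b ∈ 𝔟(C) and b′ is P-equivalent to b, then b′ ∈ 𝔟(C). -/

import Mathlib

/-- `Pmn m n = {0, 1, …, n}^m`: integer sequences `b = (b₁, …, b_m)` with `0 ≤ bᵢ ≤ n`,
encoded as lists of length `m`. -/
def Pmn (m n : ℕ) : Set (List ℕ) := {b | b.length = m ∧ ∀ x ∈ b, x ≤ n}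

/-- `Pmove n b b'` holds iff `b' = Pᵢ(b)` for some `1 ≤ i ≤ m − 1`: the move `Pᵢ` is
defined on sequences with `bᵢ < b_{i+1} < n` by
`Pᵢ(b) = (b₁, …, b_{i-1}, b_{i+1}+1, bᵢ+1, b_{i+2}, …, b_m)`. -/
def Pmove (n : ℕ) (b b' : List ℕ) : Prop :=
  ∃ (u v : List ℕ) (x y : ℕ), x < y ∧ y < n ∧
    b = u ++ x :: y :: v ∧ b' = u ++ (y + 1) :: (x + 1) :: v

/-- Boundary points of `B(m,n)` (0-indexed): `ceil j` is the ceiling point `x_{j+1}`,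
`floor j` is the floor point `x'_{j+1}`, `left i` is the left-side point `y_{i+1}`, and
`right i` is the right-side point `y'_{i+1}`. -/
inductive Bpt : Type where
  | ceil : ℕ → Bpt
  | floor : ℕ → Bpt
  | left : ℕ → Bpt
  | right : ℕ → Bpt
deriving DecidableEq

/-- The new arc created by the first entry `b₁` of a sequence: `{y₁, x₁}` if `b₁ = 0`,
`{x_n, y'₁}` if `b₁ = n`, and `{x_{b₁}, x_{b₁+1}}` if `1 ≤ b₁ ≤ n − 1`. -/
def newPair (n b₁ : ℕ) : Sym2 Bpt :=
  if b₁ = 0 then s(Bpt.left 0, Bpt.ceil 0)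
  else if b₁ = n then s(Bpt.ceil (n - 1), Bpt.right 0)
  else s(Bpt.ceil (b₁ - 1), Bpt.ceil b₁)

/-- The relabeling map from the boundary points of `B(m-1,n)` into those of `B(m,n)`
determined by the first entry `b₁`: side points `ȳᵢ, ȳ'ᵢ` become `y_{i+1}, y'_{i+1}`;
floor points are unchanged; and the ceiling points `(x̄₁, …, x̄_n)` become
`(x₂, …, x_n, y'₁)` if `b₁ = 0`, `(y₁, x₁, …, x_{n-1})` if `b₁ = n`, and
`(y₁, x₁, …, x_{b₁-1}, x_{b₁+2}, …, x_n, y'₁)` if `1 ≤ b₁ ≤ n − 1`. -/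
def relabel (n b₁ : ℕ) : Bpt → Bpt
  | .floor j => .floor j
  | .left i => .left (i + 1)
  | .right i => .right (i + 1)
  | .ceil j =>
      if b₁ = 0 then (if j = n - 1 then .right 0 else .ceil (j + 1))
      else if j = 0 then .left 0
      else if j ≤ b₁ - 1 then .ceil (j - 1)
      else if j = n - 1 then .right 0
      else .ceil (j + 1)

/-- The Catalan state (perfect matching of the boundary points of `B(m,n)`)
realized by a sequence `b ∈ P(m,n)`, defined recursively: the empty sequence pairs
`x_j` with `x'_j` for all `j < n`; for `b = b₁ :: rest`, the matching of `rest` on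
`B(m-1,n)` is transported along `relabel n b₁` and the new arc `newPair n b₁` is added. -/
def catState (n : ℕ) : List ℕ → Set (Sym2 Bpt)
  | [] => {p | ∃ j < n, p = s(Bpt.ceil j, Bpt.floor j)}
  | b₁ :: rest => insert (newPair n b₁) (Sym2.map (relabel n b₁) '' catState n rest)

/-- The fiber `𝔟(C) = {b ∈ P(m,n) : C(b) = C}` of a Catalan state `C`. -/
def bSet (m n : ℕ) (C : Set (Sym2 Bpt)) : Set (List ℕ) :=
  {b ∈ Pmn m n | catState n b = C}

/-- Relabeling along `y` and then `x` agrees with relabeling along `x + 1` and then `y + 1`. -/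
theorem relabel_comp_relabel_succ {n x y : ℕ} (hxy : x < y) (hyn : y < n) (p : Bpt) :
    relabel n (y + 1) (relabel n (x + 1) p) = relabel n x (relabel n y p) := by
  cases p with
  | ceil j => grind [relabel]
  | floor j => rfl
  | left i => rfl
  | right i => rfl

theorem map_relabel_newPair {n x y : ℕ} (hxy : x < y) (hyn : y < n) :
    Sym2.map (relabel n x) (newPair n y) = newPair n (y + 1) := by
  have hy : newPair n y = s(Bpt.ceil (y - 1), Bpt.ceil y) := by
    grind [newPair]
  rw [hy, Sym2.map_mk]
  grind [newPair, relabel]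

theorem map_relabel_newPair_succ {n x y : ℕ} (hxy : x < y) (hyn : y < n) :
    Sym2.map (relabel n (y + 1)) (newPair n (x + 1)) = newPair n x := by
  have hx : newPair n (x + 1) = s(Bpt.ceil x, Bpt.ceil (x + 1)) := by
    grind [newPair]
  rw [hx, Sym2.map_mk]
  grind [newPair, relabel]

theorem catState_append_congr {n : ℕ} {v w : List ℕ} (h : catState n v = catState n w)
    (u : List ℕ) : catState n (u ++ v) = catState n (u ++ w) := by
  induction u with
  | nil => exact h
  | cons a u ih => simp only [List.cons_append, catState, ih]

theorem catState_eq_of_Pmove {n : ℕ} {b b' : List ℕ} (h : Pmove n b b') :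
    catState n b' = catState n b := by
  obtain ⟨u, v, x, y, hxy, hyn, rfl, rfl⟩ := h
  refine catState_append_congr ?_ u
  have hcomp : relabel n (y + 1) ∘ relabel n (x + 1) = relabel n x ∘ relabel n y :=
    funext (relabel_comp_relabel_succ hxy hyn)
  simp only [catState, Set.image_insert_eq, Set.image_image, Sym2.map_map,
    map_relabel_newPair hxy hyn, map_relabel_newPair_succ hxy hyn, hcomp]
  exact Set.insert_comm _ _ _

theorem catState_eq_of_eqvGen {n : ℕ} {b b' : List ℕ}
    (h : Relation.EqvGen (Pmove n) b b') : catState n b = catState n b' := by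
  induction h with
  | rel _ _ h => exact (catState_eq_of_Pmove h).symm
  | refl _ => rfl
  | symm _ _ _ ih => exact ih.symm
  | trans _ _ _ _ _ ih₁ ih₂ => exact ih₁.trans ih₂

/-- If `b ∈ P(m,n)` and `bᵢ < b_{i+1} < n` for some `1 ≤ i ≤ m − 1`, then the matchings
`C(Pᵢ(b))` and `C(b)` coincide.  Consequently, any two `P`-equivalent sequences
`b, b' ∈ P(m,n)` satisfy `C(b) = C(b')`; in particular, if `b ∈ 𝔟(C)` and `b'` is
`P`-equivalent to `b`, then `b' ∈ 𝔟(C)`. -/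
theorem catState_Pmove_invariant (m n : ℕ) (hm : 1 ≤ m) (hn : 1 ≤ n) :
    (∀ b b', b ∈ Pmn m n → Pmove n b b' → catState n b' = catState n b) ∧
    (∀ b b', b ∈ Pmn m n → b' ∈ Pmn m n → Relation.EqvGen (Pmove n) b b' →
      catState n b = catState n b') ∧
    (∀ (C : Set (Sym2 Bpt)) (b b'), b ∈ bSet m n C → b' ∈ Pmn m n →
      Relation.EqvGen (Pmove n) b b' → b' ∈ bSet m n C) := by
  exact ⟨fun _ _ _ h => catState_eq_of_Pmove h, fun _ _ _ _ h => catState_eq_of_eqvGen h,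
    fun _ _ _ hb hb' h => ⟨hb', (catState_eq_of_eqvGen h).symm.trans hb.2⟩⟩
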